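/- (Theorem 2: conservative reformulation under matrix-connected ellipsoidal uncertainty.) In the matrix-connected ellipsoidal setting, suppose that for every sign collection n ∈ 𝒩 the inequality Σ_{t=1}^T μ_tᵀ x_t + Σ_{t=1}^T r_t √(A_{1,t}) ‖L₁ᵀ y_t(n)‖₂ + R₁(n) ≤ B holds, where L₁ is any matrix with L₁L₁ᵀ = Σ₁. Then every admissible realization sequence (d_1,…,d_T) satisfies Σ_{t=1}^T d_tᵀ x_t ≤ B. -/

import Mathlib

open Matrix Finset

/-- The Euclidean norm of a vector in `ℝⁿ`. -/
noncomputable def euclNorm {n : ℕ} (v : Fin n → ℝ) : ℝ := Real.sqrt (∑ i, v i ^ 2)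

/-- `Aprod a k t = ∏_{j=k}^{t-1} a_j` (so `Aprod a t t = 1`), the cumulative
product of the covariance-decay factors (0-indexed version of `A_{k,t}` with the
convention `A_{t,t} = 1`). -/
def Aprod (a : ℕ → ℝ) (k t : ℕ) : ℝ := ∏ j ∈ Finset.Ico k t, a j

/-- A sign collection (0-indexed): entries `s k t ∈ {−1, +1}` with `s_{T,T} = 1`. -/
def SignColl (T : ℕ) (s : ℕ → ℕ → ℝ) : Prop :=
  (∀ k t, s k t = 1 ∨ s k t = -1) ∧ s (T - 1) (T - 1) = 1

/-- Admissibility of a realization sequence in the matrix-connected ellipsoidal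
setting (0-indexed): the covariances `S` are generated from `Sig1` by
`Σ_{t+1} = a_t Σ_t + f_t (d_t − μ_t)(d_t − μ_t)ᵀ + C_t`, and each `d_t` lies in the
ellipsoid `d_t = μ_t + L_t u_t`, `‖u_t‖₂ ≤ r_t`, for some factor `L_t L_tᵀ = Σ_t`. -/
def MatrixConnectedAdmissible {n : ℕ} (T : ℕ) (μ : ℕ → Fin n → ℝ)
    (a f : ℕ → ℝ) (Cm : ℕ → Matrix (Fin n) (Fin n) ℝ)
    (Sig1 : Matrix (Fin n) (Fin n) ℝ) (r : ℕ → ℝ)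
    (d : ℕ → Fin n → ℝ) : Prop :=
  ∃ S : ℕ → Matrix (Fin n) (Fin n) ℝ, S 0 = Sig1 ∧
    (∀ t, S (t + 1) = a t • S t + f t • vecMulVec (d t - μ t) (d t - μ t) + Cm t) ∧
    (∀ t < T, ∃ (Lt : Matrix (Fin n) (Fin n) ℝ) (u : Fin n → ℝ),
      Lt * Ltᵀ = S t ∧ euclNorm u ≤ r t ∧ d t = μ t + Lt *ᵥ u)

/-- A family of vectors determined by later members of the family exists, with the weight given to
each later member allowed to depend on that member. -/
theorem exists_backward_recursion {V : Type*} [AddCommMonoid V] (N : ℕ) (x : ℕ → V)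
    (g : ℕ → ℕ → V → V) : ∃ y : ℕ → V, ∀ k, y k = x k + ∑ t ∈ Finset.Ioc k N, g k t (y t) := by
  have hwf : WellFounded fun t k : ℕ => N + 1 - t < N + 1 - k :=
    (measure fun k => N + 1 - k).wf
  have hlt : ∀ k t, t ∈ Finset.Ioc k N → N + 1 - t < N + 1 - k := by
    intro k t ht
    rw [Finset.mem_Ioc] at ht
    omega
  let F : (k : ℕ) → ((t : ℕ) → N + 1 - t < N + 1 - k → V) → V := fun k ih =>
    x k + ∑ t ∈ (Finset.Ioc k N).attach, g k t.1 (ih t.1 (hlt k t.1 t.2))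
  refine ⟨hwf.fix F, fun k => ?_⟩
  rw [hwf.fix_eq]
  exact congrArg (x k + ·) (Finset.sum_attach (Finset.Ioc k N) fun t => g k t (hwf.fix F t))

theorem Aprod_nonneg {a : ℕ → ℝ} (ha : ∀ t, 0 ≤ a t) (k t : ℕ) : 0 ≤ Aprod a k t :=
  Finset.prod_nonneg fun j _ => ha j

theorem Aprod_self (a : ℕ → ℝ) (k : ℕ) : Aprod a k k = 1 := by
  simp [Aprod]

theorem Aprod_eq_mul_succ (a : ℕ → ℝ) {k t : ℕ} (h : k < t) :
    Aprod a k t = a k * Aprod a (k + 1) t :=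
  Finset.prod_eq_prod_Ico_succ_bot h a

theorem dotProduct_le_euclNorm_mul {n : ℕ} (u v : Fin n → ℝ) :
    u ⬝ᵥ v ≤ euclNorm u * euclNorm v :=
  Real.sum_mul_le_sqrt_mul_sqrt _ u v

theorem euclNorm_transpose_mulVec {n : ℕ} (L : Matrix (Fin n) (Fin n) ℝ) (v : Fin n → ℝ) :
    euclNorm (Lᵀ *ᵥ v) = √(v ⬝ᵥ ((L * Lᵀ) *ᵥ v)) := by
  rw [← mulVec_mulVec, dotProduct_mulVec, ← mulVec_transpose, euclNorm]
  simp only [dotProduct, pow_two]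

theorem dotProduct_le_of_mem_ellipsoid {n : ℕ} {L : Matrix (Fin n) (Fin n) ℝ} {u : Fin n → ℝ}
    {ρ : ℝ} (hu : euclNorm u ≤ ρ) (v : Fin n → ℝ) :
    (L *ᵥ u) ⬝ᵥ v ≤ ρ * √(v ⬝ᵥ ((L * Lᵀ) *ᵥ v)) := by
  have h : (L *ᵥ u) ⬝ᵥ v = u ⬝ᵥ (Lᵀ *ᵥ v) := by
    rw [dotProduct_mulVec, vecMul_transpose]
  rw [h, ← euclNorm_transpose_mulVec]
  exact (dotProduct_le_euclNorm_mul _ _).trans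
    (mul_le_mul_of_nonneg_right hu (Real.sqrt_nonneg _))

theorem dotProduct_covariance_update {n : ℕ} (α φ : ℝ) (S C : Matrix (Fin n) (Fin n) ℝ)
    (e v : Fin n → ℝ) :
    v ⬝ᵥ ((α • S + φ • vecMulVec e e + C) *ᵥ v) =
      α * (v ⬝ᵥ (S *ᵥ v)) + φ * (e ⬝ᵥ v) ^ 2 + v ⬝ᵥ (C *ᵥ v) := by
  have h : vecMulVec e e *ᵥ v = (e ⬝ᵥ v) • e := by
    rw [vecMulVec_mulVec]
    ext i
    simp [mul_comm]
  simp only [add_mulVec, smul_mulVec, dotProduct_add, dotProduct_smul, smul_eq_mul, h,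
    dotProduct_comm v e]
  ring

theorem sqrt_covariance_update_le {A α φ p m c : ℝ} (hA : 0 ≤ A) (hα : 0 ≤ α) (hφ : 0 ≤ φ)
    (hp : 0 ≤ p) (hc : 0 ≤ c) :
    √A * √(α * p + φ * m ^ 2 + c) ≤ √(α * A) * √p + √(A * φ) * |m| + √(A * c) := by
  have hsub : ∀ b c : ℝ, 0 ≤ b → 0 ≤ c → √(b + c) ≤ √b + √c := fun b c hb hc =>
    Real.sqrt_le_iff.2 ⟨by positivity, by
      nlinarith [Real.sq_sqrt hb, Real.sq_sqrt hc, mul_nonneg (Real.sqrt_nonneg b)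
        (Real.sqrt_nonneg c)]⟩
  rw [← Real.sqrt_mul hA, ← Real.sqrt_mul (by positivity), ← Real.sqrt_sq_eq_abs,
    ← Real.sqrt_mul (by positivity)]
  have e : A * (α * p + φ * m ^ 2 + c) = α * A * p + A * φ * m ^ 2 + A * c := by ring
  rw [e]
  exact (hsub _ _ (by positivity) (by positivity)).trans
    (add_le_add_left (hsub _ _ (by positivity) (by positivity)) _)

theorem PosSemidef.covariance_sequence {n : ℕ} {a f : ℕ → ℝ} (ha : ∀ t, 0 ≤ a t)
    (hf : ∀ t, 0 ≤ f t) {C S : ℕ → Matrix (Fin n) (Fin n) ℝ} (hC : ∀ t, (C t).PosSemidef)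
    {e : ℕ → Fin n → ℝ} (h0 : (S 0).PosSemidef)
    (hS : ∀ t, S (t + 1) = a t • S t + f t • vecMulVec (e t) (e t) + C t) (t : ℕ) :
    (S t).PosSemidef := by
  induction t with
  | zero => exact h0
  | succ t ih =>
    rw [hS]
    have h := posSemidef_vecMulVec_self_star (e t)
    rw [star_trivial] at h
    exact ((ih.smul (ha t)).add (h.smul (hf t))).add (hC t)

/-- The deviation accumulated from time `k` on is controlled by the covariance at time `k`. -/
theorem sum_deviation_le {n T : ℕ} {r a f : ℕ → ℝ} (hr : ∀ t, 0 ≤ r t) (ha : ∀ t, 0 ≤ a t)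
    (hf : ∀ t, 0 ≤ f t) {C S : ℕ → Matrix (Fin n) (Fin n) ℝ} (hC : ∀ t, (C t).PosSemidef)
    (hSpos : ∀ t, (S t).PosSemidef) {e x y : ℕ → Fin n → ℝ} {s : ℕ → ℕ → ℝ} {R : ℕ → ℝ}
    (hS : ∀ t, S (t + 1) = a t • S t + f t • vecMulVec (e t) (e t) + C t)
    (he : ∀ t < T, ∀ v, e t ⬝ᵥ v ≤ r t * √(v ⬝ᵥ (S t *ᵥ v)))
    (hs : ∀ k t, k < t → s k t * (e k ⬝ᵥ y t) = |e k ⬝ᵥ y t|)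
    (hy : ∀ k < T, y k = x k +
      ∑ t ∈ Finset.Ico (k + 1) T, (s k t * (r t * √(Aprod a (k + 1) t * f k))) • y t)
    (hRT : R T = 0)
    (hR : ∀ k < T, R k = R (k + 1) +
      ∑ t ∈ Finset.Ico (k + 1) T, r t * √(Aprod a (k + 1) t * (y t ⬝ᵥ (C k *ᵥ y t))))
    {k : ℕ} (hk : k ≤ T) :
    ∑ t ∈ Finset.Ico k T, e t ⬝ᵥ x t ≤
      ∑ t ∈ Finset.Ico k T, r t * √(Aprod a k t) * √(y t ⬝ᵥ (S k *ᵥ y t)) + R k := by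
  induction hk using Nat.decreasingInduction with
  | self => simp [hRT]
  | of_succ k hk ih =>
    have hquad : ∀ {M : Matrix (Fin n) (Fin n) ℝ}, M.PosSemidef → ∀ v, 0 ≤ v ⬝ᵥ (M *ᵥ v) :=
      fun hM v => by simpa using hM.dotProduct_mulVec_nonneg v
    have hterm : ∀ t ∈ Finset.Ico (k + 1) T,
        r t * √(Aprod a (k + 1) t) * √(y t ⬝ᵥ (S (k + 1) *ᵥ y t)) ≤
          r t * √(Aprod a k t) * √(y t ⬝ᵥ (S k *ᵥ y t)) +
          s k t * (r t * √(Aprod a (k + 1) t * f k)) * (e k ⬝ᵥ y t) +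
          r t * √(Aprod a (k + 1) t * (y t ⬝ᵥ (C k *ᵥ y t))) := by
      intro t ht
      have hkt : k < t := (Finset.mem_Ico.1 ht).1
      have h := mul_le_mul_of_nonneg_left (sqrt_covariance_update_le (m := e k ⬝ᵥ y t)
        (Aprod_nonneg ha (k + 1) t) (ha k) (hf k) (hquad (hSpos k) (y t))
        (hquad (hC k) (y t))) (hr t)
      rw [← hs k t hkt] at h
      rw [hS, dotProduct_covariance_update, Aprod_eq_mul_succ a hkt]
      linarith
    have hsum := Finset.sum_le_sum hterm
    rw [Finset.sum_add_distrib, Finset.sum_add_distrib] at hsum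
    have hyk : e k ⬝ᵥ y k = e k ⬝ᵥ x k + ∑ t ∈ Finset.Ico (k + 1) T,
        s k t * (r t * √(Aprod a (k + 1) t * f k)) * (e k ⬝ᵥ y t) := by
      conv_lhs => rw [hy k hk]
      simp only [dotProduct_add, dotProduct_sum, dotProduct_smul, smul_eq_mul]
    have hek := he k hk (y k)
    rw [Finset.sum_eq_sum_Ico_succ_bot hk, Finset.sum_eq_sum_Ico_succ_bot hk, hR k hk,
      Aprod_self, Real.sqrt_one, mul_one]
    linarith

/-- Theorem 2: conservative reformulation under matrix-connected ellipsoidal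
uncertainty.  If for every sign collection `s` the inequality
`Σ_t μ_tᵀ x_t + Σ_t r_t √(A_{1,t}) ‖L₁ᵀ y_t(s)‖₂ + R₁(s) ≤ B` holds (with `y(s)` and
`R(s)` given by their backward recursions), then every admissible realization
sequence satisfies `Σ_t d_tᵀ x_t ≤ B`. -/
theorem matrix_connected_conservative_reformulation
    (n T : ℕ) (hn : 1 ≤ n) (hT : 1 ≤ T)
    (x : ℕ → Fin n → ℝ) (μ : ℕ → Fin n → ℝ)
    (r : ℕ → ℝ) (hr : ∀ t, 0 ≤ r t)
    (a f : ℕ → ℝ) (ha : ∀ t, 0 ≤ a t) (hf : ∀ t, 0 ≤ f t)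
    (Cm : ℕ → Matrix (Fin n) (Fin n) ℝ) (hCm : ∀ t, (Cm t).PosSemidef)
    (Sig1 : Matrix (Fin n) (Fin n) ℝ) (hSig1 : Sig1.PosSemidef)
    (L₁ : Matrix (Fin n) (Fin n) ℝ) (hL₁ : L₁ * L₁ᵀ = Sig1)
    (B : ℝ)
    (hineq : ∀ s : ℕ → ℕ → ℝ, SignColl T s →
      ∀ y : ℕ → Fin n → ℝ, ∀ R : ℕ → ℝ,
      y (T - 1) = x (T - 1) →
      (∀ k, k + 1 < T → y k = x k +
        ∑ t ∈ Finset.Ioc k (T - 1), (s k t * (r t * Real.sqrt (Aprod a (k + 1) t * f k))) • y t) →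
      R T = 0 →
      (∀ k < T, R k = R (k + 1) +
        ∑ t ∈ Finset.Ioc k (T - 1), r t * Real.sqrt (Aprod a (k + 1) t * (y t ⬝ᵥ (Cm k *ᵥ y t)))) →
      ∑ t ∈ Finset.range T, μ t ⬝ᵥ x t +
        ∑ t ∈ Finset.range T, r t * Real.sqrt (Aprod a 0 t) * euclNorm (L₁ᵀ *ᵥ y t) +
        R 0 ≤ B) :
    ∀ d : ℕ → Fin n → ℝ, MatrixConnectedAdmissible T μ a f Cm Sig1 r d →
      ∑ t ∈ Finset.range T, d t ⬝ᵥ x t ≤ B := by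
  rintro d ⟨S, hS0, hS, hd⟩
  have hIoc : ∀ k, Finset.Ioc k (T - 1) = Finset.Ico (k + 1) T := by
    intro k
    ext t
    simp only [Finset.mem_Ioc, Finset.mem_Ico]
    omega
  let e : ℕ → Fin n → ℝ := fun t => d t - μ t
  let sgn : ℕ → ℕ → (Fin n → ℝ) → ℝ := fun k t v => if k < t ∧ e k ⬝ᵥ v < 0 then -1 else 1
  obtain ⟨y, hy⟩ := exists_backward_recursion (T - 1) x fun k t v =>
    (sgn k t v * (r t * √(Aprod a (k + 1) t * f k))) • v
  let s : ℕ → ℕ → ℝ := fun k t => sgn k t (y t)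
  let c : ℕ → ℝ := fun k => ∑ t ∈ Finset.Ioc k (T - 1),
    r t * √(Aprod a (k + 1) t * (y t ⬝ᵥ (Cm k *ᵥ y t)))
  let R : ℕ → ℝ := fun k => ∑ j ∈ Finset.Ico k T, c j
  have hRT : R T = 0 := by simp [R]
  have hR : ∀ k < T, R k = R (k + 1) + c k := fun k hk => by
    simp only [R]
    rw [Finset.sum_eq_sum_Ico_succ_bot hk, add_comm]
  have hsign : SignColl T s := by
    refine ⟨fun k t => ?_, by simp [s, sgn]⟩
    simp only [s, sgn]
    split_ifs <;> simp
  have hB := hineq s hsign y R (by rw [hy]; simp) (fun k _ => hy k) hRT hR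
  have hs : ∀ k t, k < t → s k t * (e k ⬝ᵥ y t) = |e k ⬝ᵥ y t| := by
    intro k t hkt
    by_cases h : e k ⬝ᵥ y t < 0
    · simp [s, sgn, hkt, h, abs_of_neg h]
    · simp [s, sgn, h, abs_of_nonneg (not_lt.1 h)]
  have he : ∀ t < T, ∀ v, e t ⬝ᵥ v ≤ r t * √(v ⬝ᵥ (S t *ᵥ v)) := by
    intro t ht v
    obtain ⟨L, u, hL, hu, hdt⟩ := hd t ht
    have het : e t = L *ᵥ u := by simp [e, hdt]
    rw [het, ← hL]
    exact dotProduct_le_of_mem_ellipsoid hu v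
  have hmain := sum_deviation_le hr ha hf hCm
    (PosSemidef.covariance_sequence ha hf hCm (hS0 ▸ hSig1) hS) hS he hs
    (fun k _ => hIoc k ▸ hy k) hRT (fun k hk => hIoc k ▸ hR k hk) (Nat.zero_le T)
  simp only [hS0, ← hL₁, ← euclNorm_transpose_mulVec, Nat.Ico_zero_eq_range] at hmain
  have hsplit : ∑ t ∈ Finset.range T, d t ⬝ᵥ x t =
      ∑ t ∈ Finset.range T, μ t ⬝ᵥ x t + ∑ t ∈ Finset.range T, e t ⬝ᵥ x t := by
    rw [← Finset.sum_add_distrib]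
    exact Finset.sum_congr rfl fun t _ => by simp [e, sub_dotProduct]
  linarith
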